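/- arXiv:2602.17968 — 3 statements merged into one kernel-verified Lean document; each statement's English description precedes it below -/
import Mathlib

section
/- Let n ≥ 1, let W be an n×n real symmetric matrix and let G be an n×n real invertible matrix. Then the 2n×2n real symmetric block matrix C = [[W, Gᵀ], [G, 0]] has exactly n positive eigenvalues, exactly n negative eigenvalues, and no zero eigenvalues; that is, the inertia of C is (n, n, 0). -/
open Matrix

/-- If the quadratic form of `Pᵀ * diagonal d * P`, with `P` invertible, is nonpositive on the range
of an injective linear map from `V`, then at least `finrank ℝ V` of the entries of `d` are
nonpositive. -/
theorem finrank_le_card_nonpos_of_congr_diagonal {ι V : Type*} [Fintype ι] [DecidableEq ι]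
    [AddCommGroup V] [Module ℝ V] {P : Matrix ι ι ℝ} (hP : IsUnit P) (d : ι → ℝ)
    (f : V →ₗ[ℝ] ι → ℝ) (hf : Function.Injective f)
    (h : ∀ v, f v ⬝ᵥ (Pᵀ * diagonal d * P) *ᵥ f v ≤ 0) :
    Module.finrank ℝ V ≤ Fintype.card {i // d i ≤ 0} := by
  let g : V →ₗ[ℝ] {i // d i ≤ 0} → ℝ :=
    LinearMap.funLeft ℝ ℝ Subtype.val ∘ₗ P.mulVecLin ∘ₗ f
  have hg : Function.Injective g := by
    rw [injective_iff_map_eq_zero]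
    intro v hv
    have hnonpos : ∀ i, d i ≤ 0 → (P *ᵥ f v) i = 0 := fun i hi => congrFun hv ⟨i, hi⟩
    have hform : f v ⬝ᵥ (Pᵀ * diagonal d * P) *ᵥ f v = ∑ i, d i * (P *ᵥ f v) i ^ 2 := by
      rw [← mulVec_mulVec, ← mulVec_mulVec, dotProduct_mulVec, vecMul_transpose, dotProduct]
      refine Finset.sum_congr rfl fun i _ => ?_
      rw [mulVec_diagonal]
      ring
    have hterm : ∀ i ∈ Finset.univ, 0 ≤ d i * (P *ᵥ f v) i ^ 2 := by
      intro i _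
      rcases le_or_gt (d i) 0 with hi | hi
      · simp [hnonpos i hi]
      · positivity
    have hsum := le_antisymm (hform ▸ h v) (Finset.sum_nonneg hterm)
    have hzero : P *ᵥ f v = 0 := by
      funext i
      rcases le_or_gt (d i) 0 with hi | hi
      · exact hnonpos i hi
      · simpa [hi.ne'] using (Finset.sum_eq_zero_iff_of_nonneg hterm).1 hsum i (Finset.mem_univ i)
    exact hf (mulVec_injective_of_isUnit hP (by simpa using hzero))
  simpa using LinearMap.finrank_le_finrank_of_injective hg

/-- The spectral theorem for real symmetric matrices, as a congruence with a diagonal matrix. -/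
theorem Matrix.IsHermitian.eq_transpose_mul_diagonal_mul {ι : Type*} [Fintype ι] [DecidableEq ι]
    {A : Matrix ι ι ℝ} (hA : A.IsHermitian) :
    A = (hA.eigenvectorUnitary : Matrix ι ι ℝ)ᵀᵀ * diagonal hA.eigenvalues *
      (hA.eigenvectorUnitary : Matrix ι ι ℝ)ᵀ := by
  conv_lhs => rw [hA.spectral_theorem, Unitary.conjStarAlgAut_apply]
  simp [star_eq_conjTranspose]

/-- A real symmetric matrix whose quadratic form is nonpositive on the range of an injective linear
map from `V` has at least `finrank ℝ V` nonpositive eigenvalues. -/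
theorem Matrix.IsHermitian.finrank_le_card_eigenvalues_nonpos {ι V : Type*} [Fintype ι]
    [DecidableEq ι] [AddCommGroup V] [Module ℝ V] {A : Matrix ι ι ℝ} (hA : A.IsHermitian)
    (f : V →ₗ[ℝ] ι → ℝ) (hf : Function.Injective f) (h : ∀ v, f v ⬝ᵥ A *ᵥ f v ≤ 0) :
    Module.finrank ℝ V ≤ Fintype.card {i // hA.eigenvalues i ≤ 0} := by
  have hP : IsUnit (hA.eigenvectorUnitary : Matrix ι ι ℝ)ᵀ :=
    (isUnit_transpose _).2 (Unitary.toUnits hA.eigenvectorUnitary).isUnit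
  refine finrank_le_card_nonpos_of_congr_diagonal hP hA.eigenvalues f hf fun v => ?_
  convert h v using 3
  exact hA.eq_transpose_mul_diagonal_mul.symm

/-- A real symmetric matrix whose quadratic form is nonnegative on the range of an injective linear
map from `V` has at least `finrank ℝ V` nonnegative eigenvalues. -/
theorem Matrix.IsHermitian.finrank_le_card_eigenvalues_nonneg {ι V : Type*} [Fintype ι]
    [DecidableEq ι] [AddCommGroup V] [Module ℝ V] {A : Matrix ι ι ℝ} (hA : A.IsHermitian)
    (f : V →ₗ[ℝ] ι → ℝ) (hf : Function.Injective f) (h : ∀ v, 0 ≤ f v ⬝ᵥ A *ᵥ f v) :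
    Module.finrank ℝ V ≤ Fintype.card {i // 0 ≤ hA.eigenvalues i} := by
  have hP : IsUnit (hA.eigenvectorUnitary : Matrix ι ι ℝ)ᵀ :=
    (isUnit_transpose _).2 (Unitary.toUnits hA.eigenvectorUnitary).isUnit
  have hneg : ∀ v, f v ⬝ᵥ ((hA.eigenvectorUnitary : Matrix ι ι ℝ)ᵀᵀ *
      diagonal (-hA.eigenvalues) * (hA.eigenvectorUnitary : Matrix ι ι ℝ)ᵀ) *ᵥ f v ≤ 0 := by
    intro v
    rw [show diagonal (-hA.eigenvalues) = -diagonal hA.eigenvalues from (diagonal_neg _).symm,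
      mul_neg, neg_mul, ← hA.eq_transpose_mul_diagonal_mul, neg_mulVec, dotProduct_neg]
    exact neg_nonpos.2 (h v)
  simpa using finrank_le_card_nonpos_of_congr_diagonal hP (-hA.eigenvalues) f hf hneg

/-- For `n ≥ 1`, `W` an `n×n` real symmetric matrix and `G` an `n×n` real
invertible matrix, the symmetric block matrix `C = [[W, Gᵀ], [G, 0]]` has exactly `n` positive
eigenvalues, exactly `n` negative eigenvalues, and no zero eigenvalues: its inertia is
`(n, n, 0)`. -/
theorem inertia_of_block_kkt_pivot (n : ℕ) (hn : 1 ≤ n)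
    (W G : Matrix (Fin n) (Fin n) ℝ) (hW : W.IsSymm) (hG : IsUnit G)
    (hC : (Matrix.fromBlocks W Gᵀ G (0 : Matrix (Fin n) (Fin n) ℝ)).IsHermitian) :
    Fintype.card {i : Fin n ⊕ Fin n // 0 < hC.eigenvalues i} = n ∧
    Fintype.card {i : Fin n ⊕ Fin n // hC.eigenvalues i < 0} = n ∧
    Fintype.card {i : Fin n ⊕ Fin n // hC.eigenvalues i = 0} = 0 := by
  have hunit : IsUnit (fromBlocks W Gᵀ G (0 : Matrix (Fin n) (Fin n) ℝ)) := by
    refine (isUnit_iff_isUnit_det _).2 (isUnit_iff_ne_zero.2 fun hdet => ?_)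
    obtain ⟨v, hv, hCv⟩ := exists_mulVec_eq_zero_iff.2 hdet
    rw [fromBlocks_mulVec] at hCv
    have hleft : v ∘ Sum.inl = 0 := by
      apply mulVec_injective_of_isUnit hG
      funext i
      simpa using congrFun hCv (Sum.inr i)
    have hright : v ∘ Sum.inr = 0 := by
      apply mulVec_injective_of_isUnit ((isUnit_transpose G).2 hG)
      funext i
      simpa [hleft] using congrFun hCv (Sum.inl i)
    exact hv (funext (Sum.rec (congrFun hleft) (congrFun hright)))
  have hne : ∀ i, hC.eigenvalues i ≠ 0 := by
    intro i hi
    refine isUnit_iff_ne_zero.1 ((isUnit_iff_isUnit_det _).1 hunit) ?_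
    rw [hC.det_eq_prod_eigenvalues]
    exact Finset.prod_eq_zero (Finset.mem_univ i) (by simp [hi])
  let f : (Fin n → ℝ) →ₗ[ℝ] Fin n ⊕ Fin n → ℝ :=
    (LinearEquiv.sumArrowLequivProdArrow (Fin n) (Fin n) ℝ ℝ).symm.toLinearMap ∘ₗ
      LinearMap.inr ℝ _ _
  have hf : Function.Injective f :=
    (LinearEquiv.sumArrowLequivProdArrow (Fin n) (Fin n) ℝ ℝ).symm.injective.comp
      LinearMap.inr_injective
  have hf_apply : ∀ y, f y = Sum.elim (0 : Fin n → ℝ) y := by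
    intro y
    funext i
    cases i <;> rfl
  have hform : ∀ y, f y ⬝ᵥ fromBlocks W Gᵀ G 0 *ᵥ f y = 0 := by
    intro y
    rw [hf_apply, fromBlocks_mulVec, sumElim_dotProduct_sumElim]
    simp
  have hneg := hC.finrank_le_card_eigenvalues_nonpos f hf fun y => (hform y).le
  have hpos := hC.finrank_le_card_eigenvalues_nonneg f hf fun y => (hform y).ge
  have htotal := Fintype.card_subtype_compl fun i => 0 < hC.eigenvalues i
  have hle := Fintype.card_subtype_le fun i => 0 < hC.eigenvalues i
  simp only [not_lt, (hne _).le_iff_lt, (hne _).symm.le_iff_lt, Module.finrank_fin_fun,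
    Fintype.card_sum, Fintype.card_fin] at hneg hpos htotal hle
  have hzero : Fintype.card {i // hC.eigenvalues i = 0} = 0 :=
    Fintype.card_eq_zero_iff.2 ⟨fun i => hne i i.2⟩
  omega
end

section
/- Let n ≥ 1, let W be an n×n real matrix, and let G be an n×n real lower triangular matrix (G i j = 0 whenever i < j). Let C = [[W, Gᵀ], [G, 0]] be the corresponding 2n×2n block matrix, indexed by rows and columns 0, …, 2n−1. Define the row permutation ρ by ρ(i) = n + i for 0 ≤ i < n and ρ(i) = 2n − 1 − i for n ≤ i < 2n, and the column permutation γ by γ(j) = j for 0 ≤ j < n and γ(j) = 3n − 1 − j for n ≤ j < 2n. Then the permuted matrix M defined by M i j = C (ρ i) (γ j) is lower triangular: M i j = 0 whenever i < j. -/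
open Matrix

/-- Let `n ≥ 1`, `W` an `n×n` real matrix and `G` an `n×n` real lower
triangular matrix, and let `C = [[W, Gᵀ], [G, 0]]` be indexed by `0, …, 2n−1`.
With the row permutation `ρ(i) = n + i` for `i < n`, `ρ(i) = 2n − 1 − i` for `n ≤ i < 2n`,
and the column permutation `γ(j) = j` for `j < n`, `γ(j) = 3n − 1 − j` for `n ≤ j < 2n`,
the permuted matrix `M i j = C (ρ i) (γ j)` is lower triangular. -/
theorem permuted_kkt_pivot_lower_triangular (n : ℕ) (hn : 1 ≤ n)
    (W G : Matrix (Fin n) (Fin n) ℝ)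
    (hG : ∀ i j : Fin n, i < j → G i j = 0)
    (C : Matrix (Fin (2 * n)) (Fin (2 * n)) ℝ)
    (hC : C = Matrix.of fun i j : Fin (2 * n) =>
      if hi : (i : ℕ) < n then
        if hj : (j : ℕ) < n then W ⟨i, hi⟩ ⟨j, hj⟩
        else G ⟨(j : ℕ) - n, by omega⟩ ⟨i, hi⟩
      else
        if hj : (j : ℕ) < n then G ⟨(i : ℕ) - n, by omega⟩ ⟨j, hj⟩
        else 0)
    (ρ γ : Fin (2 * n) → Fin (2 * n))
    (hρ : ∀ i : Fin (2 * n),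
      (ρ i : ℕ) = if (i : ℕ) < n then n + (i : ℕ) else 2 * n - 1 - (i : ℕ))
    (hγ : ∀ j : Fin (2 * n),
      (γ j : ℕ) = if (j : ℕ) < n then (j : ℕ) else 3 * n - 1 - (j : ℕ)) :
    ∀ i j : Fin (2 * n), (i : ℕ) < (j : ℕ) → C (ρ i) (γ j) = 0 := by
  intro i j hij
  have hi := hρ i
  have hj := hγ j
  subst hC
  rw [Matrix.of_apply]
  split_ifs at hi hj ⊢ <;> first
    | rfl
    | omega
    | (apply hG; rw [Fin.lt_def]; dsimp only; omega)
end

section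
/- Let m, n ≥ 1, let A be an m×m real symmetric matrix, W an n×n real symmetric matrix, G an n×n real invertible matrix, and B a 2n×m real matrix. Let C = [[W, Gᵀ], [G, 0]] (which is invertible), let M = [[A, Bᵀ], [B, C]] be the resulting (m+2n)×(m+2n) symmetric matrix, and let S = A − Bᵀ·C⁻¹·B. Then the number of positive eigenvalues of M equals n plus the number of positive eigenvalues of S, the number of negative eigenvalues of M equals n plus the number of negative eigenvalues of S, and the number of zero eigenvalues of M equals the number of zero eigenvalues of S (all eigenvalues counted with multiplicity). -/
open Matrix

namespace Matrix

/-- A real matrix congruent to a diagonal matrix has a quadratic form equivalent to the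
corresponding weighted sum of squares. -/
lemma toQuadraticForm'_equivalent_weightedSumSquares {ι : Type*} [Fintype ι] [DecidableEq ι]
    {A P : Matrix ι ι ℝ} {w : ι → ℝ} (hP : IsUnit P) (h : Pᵀ * A * P = diagonal w) :
    A.toQuadraticForm'.Equivalent (QuadraticMap.weightedSumSquares ℝ w) := by
  refine QuadraticMap.Equivalent.symm ⟨⟨P.toLinearEquiv' hP.invertible, fun x ↦ ?_⟩⟩
  have e : (P.toLinearEquiv' hP.invertible) x = P *ᵥ x := rfl
  change A.toQuadraticForm' ((P.toLinearEquiv' hP.invertible) x) = _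
  rw [e, QuadraticMap.weightedSumSquares_apply]
  calc A.toQuadraticForm' (P *ᵥ x) = (P *ᵥ x) ⬝ᵥ A *ᵥ (P *ᵥ x) := by
        simp [toQuadraticForm', toLinearMap₂'_apply']
    _ = x ⬝ᵥ (Pᵀ * A * P) *ᵥ x := by
        rw [← mulVec_mulVec, ← mulVec_mulVec, dotProduct_mulVec x, vecMul_transpose]
    _ = ∑ i, w i • (x i * x i) := by
        rw [h]
        exact Finset.sum_congr rfl fun i _ ↦ by rw [mulVec_diagonal, smul_eq_mul]; ring

/-- The orthogonal diagonalization of a real symmetric matrix, as a congruence. -/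
lemma IsHermitian.transpose_eigenvectorUnitary_mul_mul {ι : Type*} [Fintype ι] [DecidableEq ι]
    {A : Matrix ι ι ℝ} (hA : A.IsHermitian) :
    (hA.eigenvectorUnitary : Matrix ι ι ℝ)ᵀ * A * (hA.eigenvectorUnitary : Matrix ι ι ℝ) =
      diagonal hA.eigenvalues := by
  have h := hA.conjStarAlgAut_star_eigenvectorUnitary
  rw [Unitary.conjStarAlgAut_star_apply] at h
  simpa [star_eq_conjTranspose, conjTranspose_eq_transpose_of_trivial] using! h

lemma IsHermitian.isUnit_eigenvectorUnitary {ι : Type*} [Fintype ι] [DecidableEq ι]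
    {A : Matrix ι ι ℝ} (hA : A.IsHermitian) :
    IsUnit (hA.eigenvectorUnitary : Matrix ι ι ℝ) :=
  (Unitary.toUnits hA.eigenvectorUnitary).isUnit

/-- **Sylvester's law of inertia** for eigenvalues, positive part. -/
lemma IsHermitian.card_eigenvalues_pos_eq {ι : Type*} [Fintype ι] [DecidableEq ι]
    {A P : Matrix ι ι ℝ} (hA : A.IsHermitian) {w : ι → ℝ} (hP : IsUnit P)
    (h : Pᵀ * A * P = diagonal w) :
    Fintype.card {i // 0 < hA.eigenvalues i} = Fintype.card {i // 0 < w i} := by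
  have h₁ := QuadraticForm.sigPos_of_equiv_weightedSumSquares
    (toQuadraticForm'_equivalent_weightedSumSquares hP h)
  rw [QuadraticForm.sigPos_of_equiv_weightedSumSquares
    (toQuadraticForm'_equivalent_weightedSumSquares hA.isUnit_eigenvectorUnitary
      hA.transpose_eigenvectorUnitary_mul_mul)] at h₁
  simpa only [← Nat.card_coe_set_eq, Set.coe_ofPred, Nat.card_eq_fintype_card] using h₁

/-- **Sylvester's law of inertia** for eigenvalues, negative part. -/
lemma IsHermitian.card_eigenvalues_neg_eq {ι : Type*} [Fintype ι] [DecidableEq ι]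
    {A P : Matrix ι ι ℝ} (hA : A.IsHermitian) {w : ι → ℝ} (hP : IsUnit P)
    (h : Pᵀ * A * P = diagonal w) :
    Fintype.card {i // hA.eigenvalues i < 0} = Fintype.card {i // w i < 0} := by
  have h₁ := QuadraticForm.sigNeg_of_equiv_weightedSumSquares
    (toQuadraticForm'_equivalent_weightedSumSquares hP h)
  rw [QuadraticForm.sigNeg_of_equiv_weightedSumSquares
    (toQuadraticForm'_equivalent_weightedSumSquares hA.isUnit_eigenvectorUnitary
      hA.transpose_eigenvectorUnitary_mul_mul)] at h₁
  simpa only [← Nat.card_coe_set_eq, Set.coe_ofPred, Nat.card_eq_fintype_card] using h₁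

lemma card_pos_add_card_neg_add_card_zero {ι : Type*} [Fintype ι] (w : ι → ℝ) :
    Fintype.card {i // 0 < w i} + Fintype.card {i // w i < 0} + Fintype.card {i // w i = 0} =
      Fintype.card ι := by
  classical
  simp only [Fintype.card_subtype, Finset.card_filter, ← Finset.sum_add_distrib]
  rw [Fintype.card, Finset.card_eq_sum_ones]
  refine Finset.sum_congr rfl fun i _ ↦ ?_
  rcases lt_trichotomy (w i) 0 with h | h | h
  · simp [h, h.ne, h.le]
  · simp [h]
  · simp [h, h.ne', h.le]

/-- A KKT matrix with invertible constraint block is congruent to a diagonal matrix with equally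
many entries `1` and `-1`. -/
lemma exists_isUnit_transpose_mul_kkt_mul {ν : Type*} [Fintype ν] [DecidableEq ν]
    {W G : Matrix ν ν ℝ} (hW : W.IsSymm) (hG : IsUnit G) :
    IsUnit (fromBlocks W Gᵀ G 0) ∧ ∃ T : Matrix (ν ⊕ ν) (ν ⊕ ν) ℝ, IsUnit T ∧
      Tᵀ * fromBlocks W Gᵀ G 0 * T = fromBlocks 1 0 0 (-1) := by
  have hGdet := (isUnit_iff_isUnit_det G).mp hG
  obtain ⟨H, hGH⟩ : ∃ H : Matrix ν ν ℝ, G * H = 1 := ⟨G⁻¹, mul_nonsing_inv G hGdet⟩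
  have hGH' : Hᵀ * Gᵀ = 1 := by rw [← transpose_mul, hGH, transpose_one]
  let K : Matrix ν ν ℝ := (1 / 2 : ℝ) • (Hᵀ * W * H)
  have hK : Kᵀ = K := by
    simp [K, transpose_mul, hW.eq, Matrix.mul_assoc]
  let I : Matrix ν ν ℝ := (1 / 2 : ℝ) • 1
  have hI : Iᵀ = I := by simp [I]
  have hWK : Hᵀ * (W * H) = K + K := by
    simp only [K, ← add_smul, Matrix.mul_assoc]; norm_num
  have hII : I + I = 1 := by simp only [I, ← add_smul]; norm_num
  let T : Matrix (ν ⊕ ν) (ν ⊕ ν) ℝ := fromBlocks H H (I - K) (-I - K)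
  have hT : Tᵀ * fromBlocks W Gᵀ G 0 * T = fromBlocks 1 0 0 (-1) := by
    simp only [T, fromBlocks_transpose, fromBlocks_multiply, transpose_sub, transpose_neg, hK, hI,
      Matrix.add_mul, Matrix.mul_assoc, hGH, hWK, mul_zero, add_zero, mul_one,
      hGH', one_mul]
    rw [← hII]
    congr 1 <;> abel
  have hdet : IsUnit (Tᵀ * fromBlocks W Gᵀ G 0 * T).det := by
    rw [hT, det_fromBlocks_zero₁₂, det_one, one_mul, det_neg, det_one, mul_one]
    exact isUnit_one.neg.pow _
  rw [det_mul, det_mul, IsUnit.mul_iff, IsUnit.mul_iff] at hdet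
  exact ⟨(isUnit_iff_isUnit_det _).mpr hdet.1.2, T, (isUnit_iff_isUnit_det _).mpr hdet.2, hT⟩

/-- Block elimination: a symmetric block matrix is congruent to the block diagonal matrix formed
by a congruence of the Schur complement and one of the lower right block. -/
lemma transpose_mul_fromBlocks_mul_schur {μ κ : Type*} [Fintype μ] [Fintype κ]
    [DecidableEq κ] (A U : Matrix μ μ ℝ) (B : Matrix κ μ ℝ) {C : Matrix κ κ ℝ}
    (T : Matrix κ κ ℝ) (hC : IsUnit C) (hCs : C.IsSymm) :
    (fromBlocks U 0 (-(C⁻¹ * B * U)) T)ᵀ * fromBlocks A Bᵀ B C *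
      fromBlocks U 0 (-(C⁻¹ * B * U)) T =
      fromBlocks (Uᵀ * (A - Bᵀ * C⁻¹ * B) * U) 0 0 (Tᵀ * C * T) := by
  have hCdet := (isUnit_iff_isUnit_det C).mp hC
  have h₁ : ∀ X : Matrix κ μ ℝ, C * (C⁻¹ * X) = X := fun X ↦ by
    rw [← Matrix.mul_assoc, mul_nonsing_inv C hCdet, Matrix.one_mul]
  have h₂ : ∀ X : Matrix κ κ ℝ, C⁻¹ * (C * X) = X := fun X ↦ by
    rw [← Matrix.mul_assoc, nonsing_inv_mul C hCdet, Matrix.one_mul]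
  simp [fromBlocks_transpose, fromBlocks_multiply, transpose_nonsing_inv, hCs.eq,
    Matrix.add_mul, Matrix.mul_assoc, h₁, h₂, Matrix.mul_add, sub_eq_add_neg]

end Matrix

/-- Let `m, n ≥ 1`, `A` an `m×m` real symmetric matrix, `W` an `n×n` real
symmetric matrix, `G` an `n×n` real invertible matrix, and `B` a `2n×m` real matrix.
Let `C = [[W, Gᵀ], [G, 0]]` (which is invertible), `M = [[A, Bᵀ], [B, C]]`, and
`S = A − Bᵀ·C⁻¹·B`.  Then the number of positive (resp. negative, zero) eigenvalues of `M`
equals `n` plus the number of positive (resp. `n` plus the number of negative, the number of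
zero) eigenvalues of `S`, counted with multiplicity. -/
theorem inertia_haynsworth_kkt (m n : ℕ) (hm : 1 ≤ m) (hn : 1 ≤ n)
    (A : Matrix (Fin m) (Fin m) ℝ) (W G : Matrix (Fin n) (Fin n) ℝ)
    (B : Matrix (Fin n ⊕ Fin n) (Fin m) ℝ)
    (hA : A.IsSymm) (hW : W.IsSymm) (hG : IsUnit G)
    (hM : (Matrix.fromBlocks A Bᵀ B
        (Matrix.fromBlocks W Gᵀ G (0 : Matrix (Fin n) (Fin n) ℝ))).IsHermitian)
    (hS : (A - Bᵀ * (Matrix.fromBlocks W Gᵀ G (0 : Matrix (Fin n) (Fin n) ℝ))⁻¹ *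
        B).IsHermitian) :
    IsUnit (Matrix.fromBlocks W Gᵀ G (0 : Matrix (Fin n) (Fin n) ℝ)) ∧
    Fintype.card {i : Fin m ⊕ (Fin n ⊕ Fin n) // 0 < hM.eigenvalues i} =
      n + Fintype.card {i : Fin m // 0 < hS.eigenvalues i} ∧
    Fintype.card {i : Fin m ⊕ (Fin n ⊕ Fin n) // hM.eigenvalues i < 0} =
      n + Fintype.card {i : Fin m // hS.eigenvalues i < 0} ∧
    Fintype.card {i : Fin m ⊕ (Fin n ⊕ Fin n) // hM.eigenvalues i = 0} =
      Fintype.card {i : Fin m // hS.eigenvalues i = 0} := by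
  obtain ⟨hC, T, hT, hTC⟩ := exists_isUnit_transpose_mul_kkt_mul hW hG
  set C : Matrix (Fin n ⊕ Fin n) (Fin n ⊕ Fin n) ℝ := fromBlocks W Gᵀ G 0
  have hCs : C.IsSymm := IsSymm.fromBlocks hW (transpose_transpose G) (transpose_zero)
  let U : Matrix (Fin m) (Fin m) ℝ := hS.eigenvectorUnitary
  let P := fromBlocks U 0 (-(C⁻¹ * B * U)) T
  have hP : IsUnit P := isUnit_fromBlocks_zero₁₂.mpr ⟨hS.isUnit_eigenvectorUnitary, hT⟩
  let w : Fin m ⊕ (Fin n ⊕ Fin n) → ℝ := Sum.elim hS.eigenvalues (Sum.elim (fun _ ↦ 1) (fun _ ↦ -1))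
  have hPM : Pᵀ * fromBlocks A Bᵀ B C * P = diagonal w := by
    rw [transpose_mul_fromBlocks_mul_schur A U B T hC hCs,
      hS.transpose_eigenvectorUnitary_mul_mul, hTC, ← diagonal_one, diagonal_neg,
      fromBlocks_diagonal, fromBlocks_diagonal]
  have h10 : ¬ (1 : ℝ) < 0 := not_lt.mpr zero_le_one
  have hpos : Fintype.card {i // 0 < hM.eigenvalues i} =
      n + Fintype.card {i // 0 < hS.eigenvalues i} := by
    rw [hM.card_eigenvalues_pos_eq hP hPM]
    rw [Fintype.card_congr Equiv.subtypeSum, Fintype.card_sum,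
      Fintype.card_congr Equiv.subtypeSum, Fintype.card_sum]
    simp [w, h10, add_comm]
    exact Fintype.card_congr (.refl _)
  have hneg : Fintype.card {i // hM.eigenvalues i < 0} =
      n + Fintype.card {i // hS.eigenvalues i < 0} := by
    rw [hM.card_eigenvalues_neg_eq hP hPM]
    rw [Fintype.card_congr Equiv.subtypeSum, Fintype.card_sum,
      Fintype.card_congr Equiv.subtypeSum, Fintype.card_sum]
    simp [w, h10, add_comm]
    exact Fintype.card_congr (.refl _)
  refine ⟨hC, hpos, hneg, ?_⟩
  have h₁ := card_pos_add_card_neg_add_card_zero hM.eigenvalues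
  have h₂ := card_pos_add_card_neg_add_card_zero hS.eigenvalues
  simp only [Fintype.card_sum, Fintype.card_fin] at h₁ h₂
  omega
end
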